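/- Let W, Z be independent random variables with W ~ N(0, t) and Z ~ N(0, T−t), 0 < t < T, and set H := (1/2)[(W+Z)^2/T + log(T/(T−t)) − Z^2/(T−t)]. Then P(H < 0) ≥ ℒ_t, where ℒ_t := √(t(T−t)) / (4(3t + T + 2t L_t + √2(T−t))) · exp(−(t(L_t+1)(L_t+2) + ((1+√2)/√2)(T−t))/(t(T−t))) and L_t := ((T−t)/2) log(T/(T−t)). In particular P(H < 0) > 0. -/

import Mathlib

open MeasureTheory ProbabilityTheory

lemma gaussianReal_Ioi_ge (s A : ℝ) (hs : 0 < s) :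
    Real.exp (-A ^ 2 / s) / (2 * Real.sqrt 2) ≤
      (gaussianReal 0 s.toNNReal).real (Set.Ioi A) := by
  have hv : s.toNNReal ≠ 0 := by simpa using hs
  have hcast : (s.toNNReal : ℝ) = s := Real.coe_toNNReal s hs.le
  have hint : Integrable (fun x : ℝ => Real.exp (-s⁻¹ * (x - A) ^ 2)) :=
    (integrable_exp_neg_mul_sq (inv_pos.2 hs)).comp_sub_right A
  have hshift : ∫ x in Set.Ioi A, Real.exp (-s⁻¹ * (x - A) ^ 2) = Real.sqrt (Real.pi * s) / 2 := by
    have h := integral_gaussian_Ioi s⁻¹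
    have hpre : (fun x : ℝ => x - A) ⁻¹' Set.Ioi 0 = Set.Ioi A := by
      ext x; simp
    rw [div_inv_eq_mul] at h
    rw [← h, ← (measurePreserving_sub_right volume A).setIntegral_preimage_emb
      (measurableEmbedding_subRight A) (fun x => Real.exp (-s⁻¹ * x ^ 2)), hpre]
  rw [measureReal_def, gaussianReal_apply_eq_integral _ hv,
    ENNReal.toReal_ofReal (integral_nonneg fun x => gaussianPDFReal_nonneg _ _ _)]
  calc Real.exp (-A ^ 2 / s) / (2 * Real.sqrt 2)
      = ∫ x in Set.Ioi A, (Real.sqrt (2 * Real.pi * s))⁻¹ * Real.exp (-A ^ 2 / s) *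
          Real.exp (-s⁻¹ * (x - A) ^ 2) := by
        rw [integral_const_mul, hshift, mul_assoc 2 Real.pi s,
          Real.sqrt_mul (by norm_num : (0 : ℝ) ≤ 2)]
        have : 0 < Real.sqrt (Real.pi * s) := Real.sqrt_pos.2 (by positivity)
        field_simp
    _ ≤ ∫ x in Set.Ioi A, gaussianPDFReal 0 s.toNNReal x := by
        refine setIntegral_mono (hint.integrableOn.const_mul _)
          (integrable_gaussianPDFReal _ _).integrableOn fun x => ?_
        simp only [gaussianPDFReal, hcast, mul_assoc, ← Real.exp_add]
        gcongr
        rw [← sub_nonneg]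
        have : -(x - 0) ^ 2 / (2 * s) - (-A ^ 2 / s + -s⁻¹ * (x - A) ^ 2)
            = (x - 2 * A) ^ 2 / (2 * s) := by
          field_simp
          ring
        rw [this]
        positivity

lemma gaussianReal_Icc_ge (t a b : ℝ) (ht : 0 < t) (ha : a ≤ b) (hb : b ≤ 0) :
    (b - a) * ((Real.sqrt (2 * Real.pi * t))⁻¹ * Real.exp (-a ^ 2 / (2 * t))) ≤
      (gaussianReal 0 t.toNNReal).real (Set.Icc a b) := by
  have hv : t.toNNReal ≠ 0 := by simpa using ht
  have hcast : (t.toNNReal : ℝ) = t := Real.coe_toNNReal t ht.le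
  rw [measureReal_def, gaussianReal_apply_eq_integral _ hv,
    ENNReal.toReal_ofReal (integral_nonneg fun x => gaussianPDFReal_nonneg _ _ _)]
  calc (b - a) * ((Real.sqrt (2 * Real.pi * t))⁻¹ * Real.exp (-a ^ 2 / (2 * t)))
      = ∫ x in Set.Icc a b, (Real.sqrt (2 * Real.pi * t))⁻¹ * Real.exp (-a ^ 2 / (2 * t)) := by
        simp [measureReal_def, Real.volume_Icc, ENNReal.toReal_ofReal (sub_nonneg.2 ha)]
    _ ≤ ∫ x in Set.Icc a b, gaussianPDFReal 0 t.toNNReal x := by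
        refine setIntegral_mono_on (integrableOn_const (by simp))
          (integrable_gaussianPDFReal _ _).integrableOn measurableSet_Icc fun x hx => ?_
        simp only [gaussianPDFReal, hcast, sub_zero]
        have : x ^ 2 ≤ a ^ 2 := by nlinarith [hx.1, hx.2]
        gcongr

lemma t_mul_sqrt_le (s t L : ℝ) (hs : 0 < s) (ht : 0 < t)
    (hL : s * t / (2 * s + t) ≤ L) :
    t * Real.sqrt s ≤ 11 / 100 * (8 * t * (L + 2) + 48 / 5 * s) := by
  obtain ⟨σ, hσ, rfl⟩ : ∃ σ : ℝ, 0 < σ ∧ σ ^ 2 = s :=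
    ⟨Real.sqrt s, Real.sqrt_pos.2 hs, Real.sq_sqrt hs.le⟩
  rw [Real.sqrt_sq hσ.le]
  have hd : 0 < 2 * σ ^ 2 + t := by positivity
  have key : t * σ ≤ 11 / 100 * (8 * t * (σ ^ 2 * t / (2 * σ ^ 2 + t) + 2) + 48 / 5 * σ ^ 2) := by
    rw [← sub_nonneg]
    have : 11 / 100 * (8 * t * (σ ^ 2 * t / (2 * σ ^ 2 + t) + 2) + 48 / 5 * σ ^ 2) - t * σ
        = (11 / 100 * (8 * t * (σ ^ 2 * t + 2 * (2 * σ ^ 2 + t))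
          + 48 / 5 * σ ^ 2 * (2 * σ ^ 2 + t)) - t * σ * (2 * σ ^ 2 + t)) / (2 * σ ^ 2 + t) := by
      field_simp
    rw [this]
    refine div_nonneg ?_ hd.le
    have h1 : 0 ≤ t * σ ^ 2 := by positivity
    nlinarith [sq_nonneg (σ * (t - 2 * σ)), sq_nonneg (t * (σ - 2)), sq_nonneg (t * σ),
      sq_nonneg t, sq_nonneg (σ ^ 2)]
  refine key.trans ?_
  gcongr

lemma log_ratio_ge (s t : ℝ) (hs : 0 < s) (ht : 0 < t) :
    s * t / (2 * s + t) ≤ s / 2 * Real.log ((s + t) / s) := by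
  have h := Real.le_log_one_add_of_nonneg (div_pos ht hs).le
  have e : 1 + t / s = (s + t) / s := by field_simp
  rw [e] at h
  calc s * t / (2 * s + t) = s / 2 * (2 * (t / s) / (t / s + 2)) := by
        field_simp
        ring
    _ ≤ _ := by gcongr

lemma utility_difference_neg (s t L l w z : ℝ) (hs : 0 < s) (ht : 0 < t) (hL : 0 ≤ L)
    (hl : L = s / 2 * l) (hw : w ∈ Set.Icc (-(9 / 5) : ℝ) (-1)) (hz : L + 1 < z) :
    (1 / 2) * ((w + z) ^ 2 / (s + t) + l - z ^ 2 / s) < 0 := by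
  obtain ⟨hw1, hw2⟩ := hw
  have h1 : (w + z) ^ 2 / (s + t) ≤ (w + z) ^ 2 / s := by gcongr; linarith
  have h2 : l = 2 * L / s := by rw [hl]; field_simp
  have h3 : (w + z) ^ 2 / s + 2 * L / s - z ^ 2 / s < 0 := by
    rw [← add_div, ← sub_div]
    refine div_neg_of_neg_of_pos ?_ hs
    nlinarith [mul_nonneg hL (by linarith : 0 ≤ -1 - w)]
  linarith

lemma lower_bound_le (s t L : ℝ) (hs : 0 < s) (ht : 0 < t) (hL : 0 ≤ L)
    (hL' : s * t / (2 * s + t) ≤ L) :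
    Real.sqrt (t * s) / (4 * (3 * t + (s + t) + 2 * t * L + Real.sqrt 2 * s))
        * Real.exp (-(t * (L + 1) * (L + 2)
            + ((1 + Real.sqrt 2) / Real.sqrt 2) * s) / (t * s)) ≤
      ((-1 - -(9 / 5)) * ((Real.sqrt (2 * Real.pi * t))⁻¹
        * Real.exp (-(-(9 / 5)) ^ 2 / (2 * t)))) *
        (Real.exp (-(L + 1) ^ 2 / s) / (2 * Real.sqrt 2)) := by
  have hq0 : 0 < Real.sqrt 2 := by positivity
  have hq2 : Real.sqrt 2 ^ 2 = 2 := Real.sq_sqrt (by norm_num)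
  have hq : 7 / 5 ≤ Real.sqrt 2 := Real.le_sqrt_of_sq_le (by norm_num)
  have hexp : -(t * (L + 1) * (L + 2) + ((1 + Real.sqrt 2) / Real.sqrt 2) * s) / (t * s)
      ≤ -(-(9 / 5)) ^ 2 / (2 * t) + -(L + 1) ^ 2 / s := by
    have e : (1 + Real.sqrt 2) / Real.sqrt 2 = 1 + Real.sqrt 2 / 2 := by
      field_simp
      nlinarith
    rw [e, ← sub_nonneg]
    have : -(-(9 / 5)) ^ 2 / (2 * t) + -(L + 1) ^ 2 / s
        - -(t * (L + 1) * (L + 2) + (1 + Real.sqrt 2 / 2) * s) / (t * s)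
        = (t * (L + 1) + (Real.sqrt 2 / 2 - 31 / 50) * s) / (t * s) := by
      field_simp
      ring
    rw [this]
    have : 0 ≤ Real.sqrt 2 / 2 - 31 / 50 := by linarith
    positivity
  have hpre : Real.sqrt (t * s) / (4 * (3 * t + (s + t) + 2 * t * L + Real.sqrt 2 * s)) ≤
      (-1 - -(9 / 5)) * (Real.sqrt (2 * Real.pi * t))⁻¹ / (2 * Real.sqrt 2) := by
    have hD : 8 * t * (L + 2) + 48 / 5 * s
        ≤ 4 * (3 * t + (s + t) + 2 * t * L + Real.sqrt 2 * s) := by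
      nlinarith
    have hD0 : 0 < 8 * t * (L + 2) + 48 / 5 * s := by positivity
    have hkey := t_mul_sqrt_le s t L hs ht hL'
    have hpi : Real.sqrt Real.pi ≤ 9 / 5 :=
      Real.sqrt_le_iff.2 ⟨by norm_num, by linarith [Real.pi_lt_d2]⟩
    have hpi0 : 0 < Real.sqrt Real.pi := Real.sqrt_pos.2 Real.pi_pos
    have ht0 : 0 < Real.sqrt t := Real.sqrt_pos.2 ht
    have ht2 : Real.sqrt t ^ 2 = t := Real.sq_sqrt ht.le
    calc Real.sqrt (t * s) / (4 * (3 * t + (s + t) + 2 * t * L + Real.sqrt 2 * s))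
        ≤ Real.sqrt (t * s) / (8 * t * (L + 2) + 48 / 5 * s) := by gcongr
      _ ≤ 11 / 100 / Real.sqrt t := by
        rw [div_le_div_iff₀ hD0 ht0, Real.sqrt_mul ht.le]
        calc Real.sqrt t * Real.sqrt s * Real.sqrt t = Real.sqrt t ^ 2 * Real.sqrt s := by ring
          _ = t * Real.sqrt s := by rw [ht2]
          _ ≤ _ := hkey
      _ ≤ 1 / 5 / Real.sqrt Real.pi / Real.sqrt t := by
        have : 11 / 100 ≤ 1 / 5 / Real.sqrt Real.pi := by
          rw [le_div_iff₀ hpi0]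
          linarith
        gcongr
      _ = _ := by
        rw [Real.sqrt_mul (by positivity), Real.sqrt_mul (by norm_num)]
        field_simp
        nlinarith
  calc _ ≤ ((-1 - -(9 / 5)) * (Real.sqrt (2 * Real.pi * t))⁻¹ / (2 * Real.sqrt 2)) *
        Real.exp (-(-(9 / 5)) ^ 2 / (2 * t) + -(L + 1) ^ 2 / s) := by gcongr
    _ = _ := by
      rw [Real.exp_add]
      ring

theorem stmt_10 {Ω : Type*} [MeasureSpace Ω] [IsProbabilityMeasure (ℙ : Measure Ω)]
    (T t : ℝ) (h0 : 0 < t) (h1 : t < T) (W Z : Ω → ℝ)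
    (hWm : Measurable W) (hZm : Measurable Z)
    (hW : Measure.map W ℙ = gaussianReal 0 t.toNNReal)
    (hZ : Measure.map Z ℙ = gaussianReal 0 (T - t).toNNReal)
    (hind : IndepFun W Z ℙ) (L 𝓛 : ℝ)
    (hLdef : L = ((T - t) / 2) * Real.log (T / (T - t)))
    (h𝓛def : 𝓛 =
      Real.sqrt (t * (T - t)) / (4 * (3 * t + T + 2 * t * L + Real.sqrt 2 * (T - t)))
        * Real.exp (-(t * (L + 1) * (L + 2)
            + ((1 + Real.sqrt 2) / Real.sqrt 2) * (T - t)) / (t * (T - t)))) :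
    𝓛 ≤ (ℙ {ω | (1 / 2) * ((W ω + Z ω) ^ 2 / T + Real.log (T / (T - t))
        - (Z ω) ^ 2 / (T - t)) < 0}).toReal ∧
      0 < ℙ {ω | (1 / 2) * ((W ω + Z ω) ^ 2 / T + Real.log (T / (T - t))
        - (Z ω) ^ 2 / (T - t)) < 0} := by
  obtain ⟨s, rfl⟩ : ∃ s, T = s + t := ⟨T - t, by ring⟩
  simp only [add_sub_cancel_right] at *
  have hs : 0 < s := by linarith
  have hLs : s * t / (2 * s + t) ≤ L := hLdef ▸ log_ratio_ge s t hs h0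
  have hL : 0 ≤ L := le_trans (by positivity) hLs
  have hsub : W ⁻¹' Set.Icc (-(9 / 5)) (-1) ∩ Z ⁻¹' Set.Ioi (L + 1) ⊆
      {ω | (1 / 2) * ((W ω + Z ω) ^ 2 / (s + t) + Real.log ((s + t) / s)
        - (Z ω) ^ 2 / s) < 0} :=
    fun ω hω => utility_difference_neg s t L _ _ _ hs h0 hL hLdef hω.1 hω.2
  have hprod : (ℙ : Measure Ω).real (W ⁻¹' Set.Icc (-(9 / 5)) (-1) ∩ Z ⁻¹' Set.Ioi (L + 1)) =
      (gaussianReal 0 t.toNNReal).real (Set.Icc (-(9 / 5)) (-1)) *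
        (gaussianReal 0 s.toNNReal).real (Set.Ioi (L + 1)) := by
    simp only [measureReal_def]
    rw [hind.measure_inter_preimage_eq_mul _ _ measurableSet_Icc measurableSet_Ioi,
      ENNReal.toReal_mul, ← hW, ← hZ, Measure.map_apply hWm measurableSet_Icc,
      Measure.map_apply hZm measurableSet_Ioi]
  have hmain : 𝓛 ≤ (ℙ {ω | (1 / 2) * ((W ω + Z ω) ^ 2 / (s + t) + Real.log ((s + t) / s)
        - (Z ω) ^ 2 / s) < 0}).toReal := by
    refine le_trans ?_ (measureReal_mono hsub)
    rw [hprod, h𝓛def]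
    refine (lower_bound_le s t L hs h0 hL hLs).trans ?_
    exact mul_le_mul (gaussianReal_Icc_ge t _ _ h0 (by norm_num) (by norm_num))
      (gaussianReal_Ioi_ge s _ hs) (by positivity) measureReal_nonneg
  refine ⟨hmain, ?_⟩
  have hpos : 0 < 𝓛 := by
    rw [h𝓛def]
    positivity
  exact (ENNReal.toReal_pos_iff.1 (hpos.trans_le hmain)).1
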